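/- Let G be a finite simple graph on N vertices with adjacency matrix A, degree matrix D, and let M be the 2N × 2N block matrix M = [[A, I − D],[I, 0]]. Then for every κ ∈ ℝ, the characteristic polynomial of M satisfies det(κ·I_{2N} − M) = det((κ² − 1)·I_N + D − κ·A). -/

import Mathlib

open Finset

/-- A `2 × 2` block determinant whose lower blocks are `-1` and a scalar matrix. -/
theorem Matrix.det_fromBlocks_neg_one_smul_one {n R : Type*} [Fintype n] [DecidableEq n]
    [CommRing R] (X Y : Matrix n n R) (r : R) :
    (Matrix.fromBlocks X Y (-1) (r • (1 : Matrix n n R))).det = (r • X + Y).det := by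
  have hQ : (Matrix.fromBlocks (r • (1 : Matrix n n R)) ((r - 1) • (1 : Matrix n n R)) 1 1).det
      = 1 := by
    rw [Matrix.det_fromBlocks_one₂₂, Matrix.mul_one, ← sub_smul, sub_sub_cancel, one_smul,
      Matrix.det_one]
  rw [← mul_one (Matrix.det _), ← hQ, ← Matrix.det_mul, Matrix.fromBlocks_multiply]
  have h₂₁ : (-1) * (r • (1 : Matrix n n R)) + (r • 1) * 1 = 0 := by simp
  have h₂₂ : (-1) * ((r - 1) • (1 : Matrix n n R)) + (r • 1) * 1 = 1 := by simp [sub_smul]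
  rw [h₂₁, h₂₂, Matrix.det_fromBlocks_zero₂₁, Matrix.det_one, mul_one]
  simp

/-- The characteristic polynomial of the `2N × 2N` Ihara matrix `M = [[A, I-D],[I,0]]`
of a finite simple graph satisfies
`det(κ I_{2N} - M) = det((κ²-1) I_N + D - κ A)` for every real `κ`. -/
theorem ihara_char_poly (N : ℕ) (A : Matrix (Fin N) (Fin N) ℝ)
    (hA01 : ∀ i j, A i j = 0 ∨ A i j = 1)
    (hSymm : ∀ i j, A i j = A j i)
    (hDiag : ∀ i, A i i = 0)
    (D : Matrix (Fin N) (Fin N) ℝ)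
    (hD : D = Matrix.diagonal (fun i => ∑ j, A i j))
    (M : Matrix (Fin N ⊕ Fin N) (Fin N ⊕ Fin N) ℝ)
    (hM : M = Matrix.fromBlocks A (1 - D) 1 0) :
    ∀ κ : ℝ,
      (κ • (1 : Matrix (Fin N ⊕ Fin N) (Fin N ⊕ Fin N) ℝ) - M).det
        = ((κ ^ 2 - 1) • (1 : Matrix (Fin N) (Fin N) ℝ) + D - κ • A).det := by
  intro κ
  have h : κ • (1 : Matrix (Fin N ⊕ Fin N) (Fin N ⊕ Fin N) ℝ) - M
      = Matrix.fromBlocks (κ • 1 - A) (D - 1) (-1) (κ • 1) := by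
    rw [hM, ← Matrix.fromBlocks_one, Matrix.fromBlocks_smul, sub_eq_add_neg,
      Matrix.fromBlocks_neg, Matrix.fromBlocks_add]
    simp [sub_eq_add_neg, add_comm]
  rw [h, Matrix.det_fromBlocks_neg_one_smul_one]
  congr 1
  module
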